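/- Let X be a nontrivial transitive nearest-neighbor SFT on n symbols and Y the SFT obtained from X by forbidding a single word w of length k > 1 in L(X). Then h_top(X) − h_top(Y) > h_top(X) · e^{−2(3n+4k) h_top(X)}. -/

import Mathlib

open Filter Topology MeasureTheory Set

def shiftMap (A : Type*) : (ℤ → A) → (ℤ → A) := fun x n => x (n + 1)

def occursAt {A : Type*} (x : ℤ → A) (i : ℤ) (w : List A) : Prop :=
  ∀ j : Fin w.length, x (i + (j : ℕ)) = w.get j

def inLang {A : Type*} (X : Set (ℤ → A)) (w : List A) : Prop :=
  ∃ x ∈ X, occursAt x 0 w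

def sftCover {A : Type*} (X : Set (ℤ → A)) (n : ℕ) : Set (ℤ → A) :=
  { x | ∀ (i : ℤ) (w : List A), w.length ≤ n → occursAt x i w → inLang X w }

def IsSubshift {A : Type*} [TopologicalSpace A] (X : Set (ℤ → A)) : Prop :=
  X.Nonempty ∧ IsClosed X ∧ shiftMap A '' X = X

def minPeriodPts {A : Type*} (S : Set (ℤ → A)) (p : ℕ) : Set (ℤ → A) :=
  { x ∈ S | (shiftMap A)^[p] x = x ∧ ∀ q : ℕ, 0 < q → q < p → (shiftMap A)^[q] x ≠ x }

def PeriodStable {A : Type*} (X : Set (ℤ → A)) : Prop :=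
  ∀ m : ℕ, ∃ n p : ℕ, 0 < p ∧
    minPeriodPts (sftCover X n) p = minPeriodPts (sftCover X (n + m)) p

def LanguageStable {A : Type*} (X : Set (ℤ → A)) : Prop :=
  ∀ m : ℕ, ∃ n : ℕ, sftCover X n = sftCover X (n + m)

def TopMixing {A : Type*} (X : Set (ℤ → A)) : Prop :=
  ∀ u v : List A, inLang X u → inLang X v →
    ∃ N : ℕ, ∀ n ≥ N, ∃ w : List A, w.length = n ∧ inLang X (u ++ w ++ v)

def LangTransitive {A : Type*} (X : Set (ℤ → A)) : Prop :=
  ∀ u v : List A, inLang X u → inLang X v → ∃ w : List A, inLang X (u ++ w ++ v)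

def globalSlide {A : Type*} (R : ℕ) (Φ : List A → A) : (ℤ → A) → (ℤ → A) :=
  fun x i => Φ (List.ofFn (fun j : Fin (2 * R + 1) => x (i - R + (j : ℕ))))

def wordSlide {A : Type*} (R : ℕ) (Φ : List A → A) (w : List A) : List A :=
  (List.range (w.length - 2 * R)).map (fun j => Φ ((w.drop j).take (2 * R + 1)))

noncomputable def subshiftEntropy {A : Type*} (X : Set (ℤ → A)) : ℝ :=
  Filter.limsup
    (fun n : ℕ => Real.log (Nat.card { w : List A // w.length = n ∧ inLang X w }) / n)
    Filter.atTop

def IsNNSFT {A : Type*} (X : Set (ℤ → A)) : Prop :=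
  ∃ F : Set (List A), (∀ w ∈ F, w.length ≤ 2) ∧
    X = { x | ∀ (i : ℤ) (w : List A), w ∈ F → ¬ occursAt x i w }

noncomputable def xi (s : ℕ) : ℝ :=
  30 * (s : ℝ) ^ (3 * (s ^ 2 + 1)) /
    (1 - Real.rpow (1 - 1 / (4 * (s : ℝ) ^ (2 * s ^ 2))) (1 / (s ^ 2 : ℝ)))

noncomputable def measEntropy {A : Type*} [Fintype A] [MeasurableSpace A]
    (μ : MeasureTheory.Measure (ℤ → A)) : ℝ :=
  Filter.limsup
    (fun n : ℕ =>
      (∑ w : Fin n → A,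
        Real.negMulLog ((μ { x : ℤ → A | ∀ j : Fin n, x ((j : ℕ) : ℤ) = w j }).toReal)) / n)
    Filter.atTop

theorem occursAt_iff_getElem {A : Type*} {x : ℤ → A} {i : ℤ} {w : List A} :
    occursAt x i w ↔ ∀ (j : ℕ) (h : j < w.length), x (i + j) = w[j] :=
  ⟨fun h j hj => h ⟨j, hj⟩, fun h j => h j j.2⟩

theorem occursAt_append {A : Type*} {x : ℤ → A} {i : ℤ} {u v : List A} :
    occursAt x i (u ++ v) ↔ occursAt x i u ∧ occursAt x (i + u.length) v := by
  simp only [occursAt_iff_getElem]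
  constructor
  · intro h
    refine ⟨fun j hj => ?_, fun j hj => ?_⟩
    · rw [h j (by simp; omega), List.getElem_append_left hj]
    · have := h (u.length + j) (by simp; omega)
      rw [List.getElem_append_right (by omega)] at this
      simpa [add_assoc] using this
  · rintro ⟨h1, h2⟩ j hj
    by_cases hju : j < u.length
    · rw [h1 j hju, List.getElem_append_left hju]
    · rw [List.getElem_append_right (by omega), ← h2 (j - u.length) (by simp at hj; omega)]
      congr 1
      push_cast [Nat.cast_sub (not_lt.mp hju)]
      ring

theorem occursAt_translate {A : Type*} {x : ℤ → A} {i j : ℤ} {w : List A} :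
    occursAt (fun n => x (n + j)) i w ↔ occursAt x (i + j) w := by
  simp only [occursAt_iff_getElem, add_right_comm]

theorem occursAt_ofFn {A : Type*} (x : ℤ → A) (i : ℤ) (N : ℕ) :
    occursAt x i (List.ofFn fun j : Fin N => x (i + (j : ℕ))) := by
  simp [occursAt_iff_getElem]

namespace IsNNSFT

variable {A : Type*} {X : Set (ℤ → A)}

theorem translate_mem (hX : IsNNSFT X) {x : ℤ → A} (hx : x ∈ X) (j : ℤ) :
    (fun n => x (n + j)) ∈ X := by
  obtain ⟨F, -, rfl⟩ := hX
  intro i w hw h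
  exact hx _ w hw (occursAt_translate.mp h)

theorem inLang_of_occursAt (hX : IsNNSFT X) {x : ℤ → A} (hx : x ∈ X) {i : ℤ} {w : List A}
    (h : occursAt x i w) : inLang X w :=
  ⟨_, hX.translate_mem hx i, occursAt_translate.mpr (by simpa using h)⟩

theorem mem_of_forall_inLang_pair (hX : IsNNSFT X) {x : ℤ → A}
    (h : ∀ i, inLang X [x i, x (i + 1)]) : x ∈ X := by
  obtain ⟨F, hF, rfl⟩ := hX
  intro i v hv hocc
  obtain ⟨y, hy, hyocc⟩ := h i
  refine hy 0 v hv ?_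
  rw [occursAt_iff_getElem] at hocc hyocc ⊢
  intro j hj
  have hj2 : j < 2 := hj.trans_le (hF v hv)
  rw [← hocc j hj, hyocc j (by simpa using hj2)]
  interval_cases j <;> simp

theorem inLang_pair (hX : IsNNSFT X) {x : ℤ → A} (hx : x ∈ X) (i : ℤ) :
    inLang X [x i, x (i + 1)] := by
  refine hX.inLang_of_occursAt hx (i := i) ?_
  rw [occursAt_iff_getElem]
  intro j hj
  have : j < 2 := by simpa using hj
  interval_cases j <;> simp

theorem inLang_of_isInfix (hX : IsNNSFT X) {u v : List A} (hv : inLang X v) (h : u <:+: v) :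
    inLang X u := by
  obtain ⟨s, t, rfl⟩ := h
  obtain ⟨x, hx, hocc⟩ := hv
  exact hX.inLang_of_occursAt hx (occursAt_append.mp (occursAt_append.mp hocc).1).2

theorem inLang_glue (hX : IsNNSFT X) {u v : List A} {a : A} (hu : inLang X (u ++ [a]))
    (hv : inLang X (a :: v)) : inLang X (u ++ a :: v) := by
  obtain ⟨x, hx, hxo⟩ := hu
  obtain ⟨y, hy, hyo⟩ := hv
  obtain ⟨hxu, hxa⟩ := occursAt_append.mp hxo
  have hxa : x u.length = a := by simpa using occursAt_iff_getElem.mp hxa 0 (by simp)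
  have hya : y 0 = a := occursAt_iff_getElem.mp hyo 0 (by simp)
  set t : ℤ → A := fun n => if n < u.length then x n else y (n - u.length) with ht
  have hlt : ∀ n : ℤ, n ≤ u.length → t n = x n := by
    intro n hn
    rcases hn.lt_or_eq with h | rfl
    · simp [ht, h]
    · simp [ht, hxa, hya]
  have hge : ∀ n : ℤ, (u.length : ℤ) ≤ n → t n = y (n - u.length) := by
    intro n hn
    simp [ht, not_lt.mpr hn]
  refine ⟨t, hX.mem_of_forall_inLang_pair fun i => ?_, occursAt_append.mpr ⟨?_, ?_⟩⟩
  · rcases lt_or_ge i u.length with h | h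
    · rw [hlt i h.le, hlt (i + 1) (by omega)]
      exact hX.inLang_pair hx i
    · rw [hge i h, hge (i + 1) (by omega), add_sub_right_comm]
      exact hX.inLang_pair hy _
  · rw [occursAt_iff_getElem] at hxu ⊢
    intro j hj
    rw [hlt _ (by omega), hxu j hj]
  · rw [occursAt_iff_getElem] at hyo ⊢
    intro j hj
    rw [hge _ (by omega), ← hyo j hj]
    congr 1
    ring

theorem exists_short_connection [Fintype A] (hX : IsNNSFT X) (hT : LangTransitive X) {a b : A}
    (ha : inLang X [a]) (hb : inLang X [b]) :
    ∃ u : List A, u.length ≤ Fintype.card A ∧ inLang X (a :: u ++ [b]) := by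
  classical
  have hex : ∃ n, ∃ u : List A, u.length = n ∧ inLang X (a :: u ++ [b]) := by
    obtain ⟨u, hu⟩ := hT [a] [b] ha hb
    exact ⟨_, u, rfl, by simpa using hu⟩
  obtain ⟨u, hlen, hu⟩ := Nat.find_spec hex
  refine ⟨u, List.Nodup.length_le_card ?_, hu⟩
  by_contra hnd
  obtain ⟨c, hc⟩ := List.exists_duplicate_iff_not_nodup.mpr hnd
  rw [List.duplicate_iff_sublist] at hc
  obtain ⟨p, q, rfl, hp, hq⟩ : ∃ p q, u = p ++ q ∧ c ∈ p ∧ c ∈ q := by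
    obtain ⟨p, q, rfl, hp, hq⟩ := List.append_sublist_iff.mp
      (show List.Sublist ([c] ++ [c]) u from hc)
    exact ⟨p, q, rfl, by simpa using hp, by simpa using hq⟩
  obtain ⟨s, t, rfl⟩ := List.append_of_mem hp
  obtain ⟨s', t', rfl⟩ := List.append_of_mem hq
  have h1 : inLang X (a :: s ++ [c]) := hX.inLang_of_isInfix hu
    ⟨[], t ++ (s' ++ c :: t') ++ [b], by simp⟩
  have h2 : inLang X (c :: (t' ++ [b])) := hX.inLang_of_isInfix hu
    ⟨a :: s ++ c :: t ++ s', [], by simp⟩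
  have h3 := hX.inLang_glue h1 h2
  refine Nat.find_min hex (m := (s ++ c :: t').length) ?_ ⟨_, rfl, by simpa using h3⟩
  rw [← hlen]
  simp
  omega

theorem exists_detour [Fintype A] (hX : IsNNSFT X) (hT : LangTransitive X) {w : List A}
    (hw : inLang X w) (hne : w ≠ []) {a : A} (ha : inLang X [a]) :
    ∃ p q : List A, p.length ≤ Fintype.card A ∧ q.length ≤ Fintype.card A ∧
      inLang X (a :: (p ++ w ++ q ++ [a])) := by
  obtain ⟨b, w', rfl⟩ := List.exists_cons_of_ne_nil hne
  obtain ⟨p, hp, hpL⟩ := hX.exists_short_connection hT ha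
    (hX.inLang_of_isInfix hw (u := [b]) ⟨[], w', by simp⟩)
  have h1 : inLang X (a :: p ++ b :: w') := hX.inLang_glue hpL hw
  obtain ⟨v, c, hvc⟩ : ∃ v c, b :: w' = v ++ [c] :=
    ⟨_, _, (List.dropLast_append_getLast hne).symm⟩
  rw [hvc] at h1
  obtain ⟨q, hq, hqL⟩ := hX.exists_short_connection hT
    (hX.inLang_of_isInfix h1 (u := [c]) ⟨a :: p ++ v, [], by simp⟩) ha
  refine ⟨p, q, hp, hq, ?_⟩
  have := hX.inLang_glue (u := a :: p ++ v) (by simpa using h1) hqL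
  rw [hvc]
  simpa using this

end IsNNSFT

open Classical in
/-- The words obtained from `y` by inserting `D a`, or not, after the last letter `a` of each of its
first `m` blocks of length `B`. -/
noncomputable def insertions {A : Type*} (D : A → List A) (B : ℕ) :
    ℕ → List A → Finset (List A)
  | 0, y => {y}
  | m + 1, y =>
    (insertions D B m (y.drop B)).image (fun u => y.take B ++ u) ∪
    (insertions D B m (y.drop B)).image
      (fun u => y.take B ++ ((y.take B).getLast?.elim [] D ++ u))

section insertions

variable {A : Type*} {D : A → List A} {B : ℕ} {w : List A}

theorem mem_insertions_succ {m : ℕ} {y u : List A} :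
    u ∈ insertions D B (m + 1) y ↔ ∃ r ∈ insertions D B m (y.drop B),
      u = y.take B ++ r ∨ u = y.take B ++ ((y.take B).getLast?.elim [] D ++ r) := by
  classical
  simp only [insertions, Finset.mem_union, Finset.mem_image]
  grind

theorem isInfix_of_isPrefix_insertions {m : ℕ} {y u p : List A} (hu : u ∈ insertions D B m y)
    (hy : B * m ≤ y.length) (hp : p ++ w <+: u) (hlen : (p ++ w).length ≤ B) : w <:+: y := by
  cases m with
  | zero =>
    obtain rfl : u = y := by simpa [insertions] using hu
    exact (List.infix_append p w []).trans (by simpa using hp.isInfix)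
  | succ m =>
    obtain ⟨r, rfl⟩ : ∃ r, u = y.take B ++ r := by
      obtain ⟨r, -, rfl | rfl⟩ := mem_insertions_succ.mp hu
      exacts [⟨_, rfl⟩, ⟨_, rfl⟩]
    have hB : B ≤ y.length := by nlinarith
    have h2 : p ++ w <+: y.take B :=
      List.prefix_of_prefix_length_le hp (List.prefix_append _ _) (by simpa [hB] using hlen)
    exact (List.infix_append p w []).trans
      (by simpa using h2.isInfix.trans (List.take_prefix B y).isInfix)

theorem exists_take_eq_append_singleton (hB : 0 < B) {y : List A} (hy : B ≤ y.length) :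
    ∃ v a, y.take B = v ++ [a] := by
  have : y.take B ≠ [] := by
    rw [← List.length_pos_iff]
    simp
    omega
  exact ⟨_, _, (List.dropLast_append_getLast this).symm⟩

theorem append_notMem_insertions (hD : ∀ a, ∃ p q, D a = p ++ w ++ q ∧ (p ++ w).length ≤ B)
    {m : ℕ} {y r : List A} {a : A} (hy : B * m ≤ y.length) (hfree : ¬ w <:+: y) :
    D a ++ r ∉ insertions D B m y := by
  intro h
  obtain ⟨p, q, hpq, hlen⟩ := hD a
  exact hfree (isInfix_of_isPrefix_insertions h hy ⟨q ++ r, by simp [hpq]⟩ hlen)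

theorem not_isInfix_drop {y : List A} (h : ¬ w <:+: y) (B : ℕ) : ¬ w <:+: y.drop B :=
  fun h' => h (h'.trans (List.drop_suffix B y).isInfix)

theorem eq_of_mem_insertions (hD : ∀ a, ∃ p q, D a = p ++ w ++ q ∧ (p ++ w).length ≤ B)
    (hB : 0 < B) {m : ℕ} {y y' u : List A} (hlen : y.length = y'.length)
    (hy : B * m ≤ y.length) (hf : ¬ w <:+: y) (hf' : ¬ w <:+: y')
    (hu : u ∈ insertions D B m y) (hu' : u ∈ insertions D B m y') : y = y' := by
  induction m generalizing y y' u with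
  | zero =>
    simp only [insertions, Finset.mem_singleton] at hu hu'
    exact hu.symm.trans hu'
  | succ m ih =>
    have hBy : B ≤ y.length := by nlinarith
    have hd : B * m ≤ (y.drop B).length := by
      simp only [List.length_drop]
      rw [mul_add] at hy
      omega
    have hdl : (y.drop B).length = (y'.drop B).length := by simp [hlen]
    have hd' : B * m ≤ (y'.drop B).length := hdl ▸ hd
    have htl : (y.take B).length = (y'.take B).length := by simp [hlen]
    obtain ⟨v, a, hva⟩ := exists_take_eq_append_singleton hB hBy
    have hlast : (y.take B).getLast?.elim [] D = D a := by simp [hva]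
    suffices y.take B = y'.take B ∧ y.drop B = y'.drop B by
      rw [← List.take_append_drop B y, this.1, this.2, List.take_append_drop]
    have hg := not_isInfix_drop hf B
    have hg' := not_isInfix_drop hf' B
    obtain ⟨r, hr, rfl | rfl⟩ := mem_insertions_succ.mp hu <;>
      obtain ⟨r', hr', h | h⟩ := mem_insertions_succ.mp hu' <;>
      obtain ⟨ht, h⟩ := List.append_inj h htl
    · exact ⟨ht, ih hdl hd hg hg' hr (h ▸ hr')⟩
    · rw [← ht, hlast] at h
      exact (append_notMem_insertions hD hd hg (h ▸ hr)).elim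
    · rw [hlast] at h
      exact (append_notMem_insertions hD hd' hg' (h ▸ hr')).elim
    · rw [← ht, hlast] at h
      exact ⟨ht, ih hdl hd hg hg' hr (List.append_cancel_left h ▸ hr')⟩

theorem le_sum_insertions (hD : ∀ a, ∃ p q, D a = p ++ w ++ q ∧ (p ++ w).length ≤ B)
    (hB : 0 < B) {L : ℕ} (hL : ∀ a, (D a).length ≤ L) {z : ℝ} (hz : 0 < z) (hz1 : z ≤ 1)
    {m : ℕ} {y : List A} (hy : B * m ≤ y.length) (hf : ¬ w <:+: y) :
    z ^ y.length * (1 + z ^ L) ^ m ≤ ∑ u ∈ insertions D B m y, z ^ u.length := by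
  classical
  induction m generalizing y with
  | zero => simp [insertions]
  | succ m ih =>
    have hBy : B ≤ y.length := by nlinarith
    have hd : B * m ≤ (y.drop B).length := by
      simp only [List.length_drop]
      rw [mul_add] at hy
      omega
    obtain ⟨v, a, hva⟩ := exists_take_eq_append_singleton hB hBy
    have hlast : (y.take B).getLast?.elim [] D = D a := by simp [hva]
    have hg := not_isInfix_drop hf B
    rw [insertions, hlast, Finset.sum_union, Finset.sum_image, Finset.sum_image]
    · have hsum := ih hd hg
      set σ := ∑ u ∈ insertions D B m (y.drop B), z ^ u.length with hσ
      have e1 : ∑ u ∈ insertions D B m (y.drop B), z ^ (y.take B ++ u).length = z ^ B * σ := by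
        simp [hσ, Finset.mul_sum, pow_add, hBy]
      have e2 : ∑ u ∈ insertions D B m (y.drop B), z ^ (y.take B ++ (D a ++ u)).length
          = z ^ B * (z ^ (D a).length * σ) := by
        simp [hσ, Finset.mul_sum, pow_add, hBy]
      have hσ0 : 0 ≤ σ := Finset.sum_nonneg fun _ _ => by positivity
      have hzL : z ^ L ≤ z ^ (D a).length := pow_le_pow_of_le_one hz.le hz1 (hL a)
      have hsplit : z ^ y.length = z ^ B * z ^ (y.drop B).length := by
        rw [← pow_add, List.length_drop, Nat.add_sub_cancel' hBy]
      rw [e1, e2, hsplit]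
      calc z ^ B * z ^ (y.drop B).length * (1 + z ^ L) ^ (m + 1)
          = z ^ B * (1 + z ^ L) * (z ^ (y.drop B).length * (1 + z ^ L) ^ m) := by ring
        _ ≤ z ^ B * (1 + z ^ (D a).length) * σ := by gcongr
        _ = _ := by ring
    · intro r _ r' _ h
      simpa using h
    · intro r _ r' _ h
      simpa using h
    · rw [Finset.disjoint_left]
      intro u h1 h2
      obtain ⟨r, hr, rfl⟩ := Finset.mem_image.mp h1
      obtain ⟨r', -, h⟩ := Finset.mem_image.mp h2
      exact append_notMem_insertions hD hd hg (List.append_cancel_left h ▸ hr)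

theorem inLang_append_of_mem_insertions {X : Set (ℤ → A)} (hX : IsNNSFT X)
    (hD : ∀ a, inLang X [a] → ∃ s, D a = s ++ [a] ∧ inLang X (a :: D a)) (hB : 0 < B)
    {m : ℕ} {v y u : List A} (hy : B * m ≤ y.length) (hvy : inLang X (v ++ y))
    (hu : u ∈ insertions D B m y) : inLang X (v ++ u) := by
  induction m generalizing v y u with
  | zero =>
    simp only [insertions, Finset.mem_singleton] at hu
    rwa [hu]
  | succ m ih =>
    have hBy : B ≤ y.length := by nlinarith
    have hd : B * m ≤ (y.drop B).length := by
      simp only [List.length_drop]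
      rw [mul_add] at hy
      omega
    obtain ⟨t, a, hta⟩ := exists_take_eq_append_singleton hB hBy
    have hlast : (y.take B).getLast?.elim [] D = D a := by simp [hta]
    obtain ⟨r, hr, h⟩ := mem_insertions_succ.mp hu
    have hvr : inLang X (v ++ y.take B ++ r) := ih hd (by simpa using hvy) hr
    rw [hlast] at h
    obtain rfl | rfl := h
    · simpa using hvr
    · rw [hta] at hvr ⊢
      obtain ⟨s, hs, hDs⟩ := hD a (hX.inLang_of_isInfix hvr ⟨v ++ t, r, by simp⟩)
      have h1 : inLang X (v ++ t ++ [a]) := hX.inLang_of_isInfix hvr ⟨[], r, by simp⟩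
      have h2 : inLang X (a :: r) := hX.inLang_of_isInfix hvr ⟨v ++ t, [], by simp⟩
      have h3 := hX.inLang_glue h1 hDs
      rw [hs] at h3 ⊢
      simpa using hX.inLang_glue (u := v ++ t ++ a :: s) (by simpa using h3) h2

end insertions

theorem isBoundedUnder_log_natCast_div {c : ℕ → ℕ} {K : ℕ} (hc : ∀ n, c n ≤ K ^ n) :
    IsBoundedUnder (· ≤ ·) atTop (fun n : ℕ => Real.log (c n) / n) := by
  refine isBoundedUnder_of ⟨Real.log K, fun n => ?_⟩
  rcases Nat.eq_zero_or_pos n with rfl | hn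
  · simpa using Real.log_natCast_nonneg K
  rcases Nat.eq_zero_or_pos (c n) with h0 | h0
  · simpa [h0] using Real.log_natCast_nonneg K
  rw [div_le_iff₀ (by positivity), mul_comm, ← Real.log_pow]
  exact Real.log_le_log (by positivity) (by exact_mod_cast hc n)

theorem isCoboundedUnder_log_natCast_div (c : ℕ → ℕ) :
    IsCoboundedUnder (· ≤ ·) atTop (fun n : ℕ => Real.log (c n) / n) :=
  IsBoundedUnder.isCoboundedUnder_le
    (isBoundedUnder_of ⟨0, fun n => div_nonneg (Real.log_natCast_nonneg _) n.cast_nonneg⟩)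

theorem summable_mul_exp_neg_pow {c : ℕ → ℕ} {K : ℕ} (hc : ∀ n, c n ≤ K ^ n) {s : ℝ}
    (hs : limsup (fun n : ℕ => Real.log (c n) / n) atTop < s) :
    Summable fun n => (c n : ℝ) * Real.exp (-s) ^ n := by
  obtain ⟨t, ht, hts⟩ := exists_between hs
  refine Summable.of_norm_bounded_eventually_nat (g := fun n => Real.exp (t - s) ^ n)
    (summable_geometric_of_lt_one (Real.exp_pos _).le (Real.exp_lt_one_iff.mpr (by linarith))) ?_
  filter_upwards [eventually_lt_of_limsup_lt ht (isBoundedUnder_log_natCast_div hc),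
    eventually_gt_atTop 0] with n hn hn0
  rw [Real.norm_of_nonneg (by positivity), sub_eq_add_neg, Real.exp_add, mul_pow]
  gcongr
  rcases Nat.eq_zero_or_pos (c n) with h0 | h0
  · rw [h0, Nat.cast_zero]
    positivity
  rw [div_lt_iff₀ (by positivity)] at hn
  rw [← Real.exp_nat_mul, mul_comm, ← Real.log_le_iff_le_exp (by positivity)]
  exact hn.le

theorem limsup_log_div_le {c : ℕ → ℕ} {s β P : ℝ} {B : ℕ} (hB : 0 < B) (hβ : 0 < β)
    {b : ℕ → ℕ} (hcb : ∀ n, c n ≤ b n) (hb : ∀ n, 1 ≤ b n)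
    (hP : ∀ n, (b n : ℝ) * (Real.exp (-s) ^ n * (1 + β) ^ (n / B)) ≤ P) :
    limsup (fun n : ℕ => Real.log (c n) / n) atTop ≤ s - Real.log (1 + β) / B := by
  set l := Real.log (1 + β) with hl
  have hl0 : 0 < l := Real.log_pos (by linarith)
  have hlim : Tendsto (fun n : ℕ => (Real.log P + l) / n + (s - l / B)) atTop
      (𝓝 (s - l / B)) := by
    simpa using (tendsto_const_div_atTop_nhds_zero_nat (Real.log P + l)).add_const (s - l / B)
  rw [← hlim.limsup_eq]
  refine limsup_le_limsup ?_ (isCoboundedUnder_log_natCast_div c) hlim.isBoundedUnder_le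
  filter_upwards [eventually_gt_atTop 0] with n hn
  have hbpos : (0 : ℝ) < b n := by exact_mod_cast hb n
  have h1 : Real.log (c n) ≤ Real.log (b n) := by
    rcases Nat.eq_zero_or_pos (c n) with h0 | h0
    · simpa [h0] using Real.log_natCast_nonneg (b n)
    · exact Real.log_le_log (by positivity) (by exact_mod_cast hcb n)
  have h2 := Real.log_le_log (by positivity) (hP n)
  rw [Real.log_mul (by positivity) (by positivity), Real.log_mul (by positivity) (by positivity),
    Real.log_pow, Real.log_pow, Real.log_exp, ← hl] at h2
  have h3 : (n : ℝ) / B - 1 ≤ (n / B : ℕ) := by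
    have : (n : ℝ) / B < (n / B : ℕ) + 1 := by
      rw [← Nat.floor_div_eq_div (K := ℝ)]
      exact Nat.lt_floor_add_one _
    linarith
  have h4 := mul_le_mul_of_nonneg_right h3 hl0.le
  have hn' : (0 : ℝ) < n := by exact_mod_cast hn
  have hB' : (0 : ℝ) < B := by exact_mod_cast hB
  rw [div_le_iff₀ hn']
  have h5 : ((Real.log P + l) / n + (s - l / B)) * n = Real.log P + l + n * s - n / B * l := by
    field_simp
    ring
  rw [h5]
  linarith

theorem finite_length_eq_and {A : Type*} [Finite A] (p : List A → Prop) (n : ℕ) :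
    {u : List A | u.length = n ∧ p u}.Finite :=
  (List.finite_length_eq A n).subset fun _ h => h.1

theorem natCard_inLang_le {A : Type*} [Fintype A] (p : List A → Prop) (n : ℕ) :
    Nat.card {u : List A // u.length = n ∧ p u} ≤ Fintype.card A ^ n := by
  classical
  have : Nat.card {u : List A // u.length = n} = Fintype.card A ^ n := by
    rw [← card_vector, ← Nat.card_eq_fintype_card]
    rfl
  rw [← this]
  have : Finite {u : List A // u.length = n} := List.finite_length_eq A n
  exact Nat.card_le_card_of_injective (fun u => ⟨u.1, u.2.1⟩)
    fun u v h => Subtype.ext (by simpa using h)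

theorem sum_le_tsum_natCard {A : Type*} [Finite A] {p : List A → Prop} {T : Finset (List A)}
    (hT : ∀ u ∈ T, p u) {z : ℝ} (hz : 0 ≤ z)
    (hsum : Summable fun n => (Nat.card {u : List A // u.length = n ∧ p u} : ℝ) * z ^ n) :
    ∑ u ∈ T, z ^ u.length ≤ ∑' n, (Nat.card {u : List A // u.length = n ∧ p u} : ℝ) * z ^ n := by
  classical
  rw [Finset.sum_comp (fun n => z ^ n) List.length]
  refine le_trans (Finset.sum_le_sum fun n _ => ?_)
    (hsum.sum_le_tsum (T.image List.length) fun n _ => by positivity)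
  rw [nsmul_eq_mul]
  gcongr
  rw [← Set.ncard_coe_finset]
  refine Set.ncard_le_ncard (fun u hu => ?_) (finite_length_eq_and p n)
  simp only [Finset.coe_filter, Set.mem_ofPred_eq] at hu
  exact ⟨hu.2, hT u hu.1⟩

theorem natCard_free_mul_le {A : Type*} [Fintype A] {X : Set (ℤ → A)} (hX : IsNNSFT X)
    {w : List A} {D : A → List A} {B L : ℕ} (hB : 0 < B)
    (hD : ∀ a, ∃ p q, D a = p ++ w ++ q ∧ (p ++ w).length ≤ B)
    (hDX : ∀ a, inLang X [a] → ∃ s, D a = s ++ [a] ∧ inLang X (a :: D a))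
    (hL : ∀ a, (D a).length ≤ L) {z : ℝ} (hz : 0 < z) (hz1 : z ≤ 1)
    (hsum : Summable fun n => (Nat.card {u : List A // u.length = n ∧ inLang X u} : ℝ) * z ^ n)
    (N : ℕ) :
    (Nat.card {u : List A // u.length = N ∧ inLang X u ∧ ¬ w <:+: u} : ℝ) *
      (z ^ N * (1 + z ^ L) ^ (N / B)) ≤
        ∑' n, (Nat.card {u : List A // u.length = n ∧ inLang X u} : ℝ) * z ^ n := by
  classical
  have hfin := finite_length_eq_and (fun u => inLang X u ∧ ¬ w <:+: u) N
  set W := hfin.toFinset with hW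
  have hmem : ∀ u, u ∈ W ↔ u.length = N ∧ inLang X u ∧ ¬ w <:+: u := fun u => by simp [hW]
  have hcard : Nat.card {u : List A // u.length = N ∧ inLang X u ∧ ¬ w <:+: u} = W.card :=
    Set.ncard_eq_toFinset_card _ hfin
  have hlen : ∀ u ∈ W, B * (N / B) ≤ u.length := fun u hu => by
    rw [((hmem u).mp hu).1]
    exact Nat.mul_div_le N B
  refine le_trans ?_ (sum_le_tsum_natCard
    (T := W.biUnion (insertions D B (N / B))) (fun u hu => ?_) hz.le hsum)
  · rw [Finset.sum_biUnion, hcard, ← nsmul_eq_mul]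
    · refine Finset.card_nsmul_le_sum _ _ _ fun y hy => ?_
      have := le_sum_insertions hD hB hL hz hz1 (hlen y hy) ((hmem y).mp hy).2.2
      rwa [((hmem y).mp hy).1] at this
    · intro y hy y' hy' hne
      rw [Function.onFun, Finset.disjoint_left]
      intro u hu hu'
      have h1 := (hmem y).mp hy
      have h2 := (hmem y').mp hy'
      exact hne (eq_of_mem_insertions hD hB (h1.1.trans h2.1.symm) (hlen y hy) h1.2.2 h2.2.2
        hu hu')
  · obtain ⟨y, hy, hu⟩ := Finset.mem_biUnion.mp hu
    exact inLang_append_of_mem_insertions hX hDX hB (v := []) (hlen y hy)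
      ((hmem y).mp hy).2.1 hu

theorem subshiftEntropy_nonneg {A : Type*} [Fintype A] (X : Set (ℤ → A)) :
    0 ≤ subshiftEntropy X :=
  le_limsup_of_frequently_le
    (Frequently.of_forall fun n => div_nonneg (Real.log_natCast_nonneg _) n.cast_nonneg)
    (isBoundedUnder_log_natCast_div (natCard_inLang_le _))

theorem limsup_log_div_le_subshiftEntropy_sub {A : Type*} [Fintype A] {X : Set (ℤ → A)}
    (hX : IsNNSFT X) (hT : LangTransitive X) {w : List A} (hw : inLang X w) (hne : w ≠ [])
    {c : ℕ → ℕ}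
    (hc : ∀ n, c n ≤ Nat.card {u : List A // u.length = n ∧ inLang X u ∧ ¬ w <:+: u})
    (hfree : ∀ n, 1 ≤ Nat.card {u : List A // u.length = n ∧ inLang X u ∧ ¬ w <:+: u}) :
    limsup (fun n : ℕ => Real.log (c n) / n) atTop ≤ subshiftEntropy X -
      Real.log (1 + Real.exp (-subshiftEntropy X) ^ (2 * Fintype.card A + w.length + 1)) /
        (Fintype.card A + w.length : ℕ) := by
  have hex : ∀ a, ∃ p q : List A, p.length ≤ Fintype.card A ∧ q.length ≤ Fintype.card A + 1 ∧
      (inLang X [a] → ∃ s, p ++ w ++ q = s ++ [a] ∧ inLang X (a :: (p ++ w ++ q))) := by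
    intro a
    by_cases ha : inLang X [a]
    · obtain ⟨p, q, hp, hq, h⟩ := hX.exists_detour hT hw hne ha
      exact ⟨p, q ++ [a], hp, by simpa using hq, fun _ => ⟨p ++ w ++ q, by simp, by simpa using h⟩⟩
    · exact ⟨[], [], by simp, by simp, fun h => (ha h).elim⟩
  choose p q hp hq hpq using hex
  have hB : 0 < Fintype.card A + w.length := by
    have := List.length_pos_iff.mpr hne
    omega
  set L := 2 * Fintype.card A + w.length + 1
  have hlim : Tendsto (fun s : ℝ => s - Real.log (1 + Real.exp (-s) ^ L) /
      (Fintype.card A + w.length : ℕ)) (𝓝[>] subshiftEntropy X)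
      (𝓝 (subshiftEntropy X - Real.log (1 + Real.exp (-subshiftEntropy X) ^ L) /
        (Fintype.card A + w.length : ℕ))) := by
    refine Tendsto.mono_left (Continuous.tendsto ?_ _) nhdsWithin_le_nhds
    have : ∀ s : ℝ, 1 + Real.exp (-s) ^ L ≠ 0 := fun s => by positivity
    fun_prop (disch := assumption)
  refine ge_of_tendsto hlim ?_
  filter_upwards [self_mem_nhdsWithin] with s hs
  have hs0 : 0 ≤ s := (subshiftEntropy_nonneg X).trans (le_of_lt hs)
  refine limsup_log_div_le hB (by positivity) hc hfree fun N =>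
    natCard_free_mul_le hX (D := fun a => p a ++ w ++ q a) hB (fun a => ⟨p a, q a, rfl, ?_⟩) hpq
      (fun a => ?_) (Real.exp_pos _) (by simpa using hs0)
      (summable_mul_exp_neg_pow (natCard_inLang_le _) hs) N
  · simpa using hp a
  · have := hp a
    have := hq a
    simp only [List.length_append, L]
    omega

theorem log_one_add_exp_div_pos (s : ℝ) (L : ℕ) {B : ℕ} (hB : 0 < B) :
    0 < Real.log (1 + Real.exp (-s) ^ L) / B :=
  div_pos (Real.log_pos (by linarith [pow_pos (Real.exp_pos (-s)) L])) (by exact_mod_cast hB)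

theorem IsNNSFT.exists_periodic_mem {A : Type*} [Fintype A] {X : Set (ℤ → A)} (hX : IsNNSFT X)
    (hT : LangTransitive X) (hne : X.Nonempty) :
    ∃ z ∈ X, ∃ P : ℕ, 0 < P ∧ ∀ i, z (i + P) = z i := by
  obtain ⟨x, hx⟩ := hne
  have ha : inLang X [x 0] := hX.inLang_of_isInfix (hX.inLang_pair hx 0) ⟨[], [x (0 + 1)], rfl⟩
  obtain ⟨u, -, hu⟩ := hX.exists_short_connection hT ha ha
  obtain ⟨y, hy, hyo⟩ := hu
  rw [List.cons_append, ← List.singleton_append, occursAt_append, occursAt_append] at hyo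
  set P := u.length + 1 with hP
  have h0 : y 0 = x 0 := by simpa using occursAt_iff_getElem.mp hyo.1 0 (by simp)
  have h1 : y P = x 0 := by
    have := occursAt_iff_getElem.mp hyo.2.2 0 (by simp)
    simpa [hP, add_comm] using this
  have hPpos : (0 : ℤ) < P := by omega
  refine ⟨fun i => y (i % P), hX.mem_of_forall_inLang_pair fun i => ?_, P, by omega, fun i => ?_⟩
  · have hlt := Int.emod_lt_of_pos i hPpos
    have hnn := Int.emod_nonneg i hPpos.ne'
    have hsucc : y ((i + 1) % P) = y (i % P + 1) := by
      rw [← Int.emod_add_emod]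
      rcases (Int.add_one_le_of_lt hlt).lt_or_eq with h | h
      · rw [Int.emod_eq_of_lt (by omega) h]
      · rw [h, Int.emod_self, h0, h1]
    simp only [hsucc]
    exact hX.inLang_pair hy _
  · simp

theorem finite_of_forall_periodic {A : Type*} [Finite A] {X : Set (ℤ → A)} {P : ℕ} (hP : 0 < P)
    (h : ∀ x ∈ X, ∀ i, x (i + P) = x i) : X.Finite := by
  have hmod : ∀ x ∈ X, ∀ i, x (i % P) = x i := by
    intro x hx i
    have hper : Function.Periodic x (P : ℤ) := h x hx
    have := hper.int_mul (i / P) (i % P)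
    have hdiv : i % P + i / P * P = i := Int.emod_add_ediv_mul i P
    rwa [Int.cast_id, hdiv, eq_comm] at this
  refine Set.Finite.of_finite_image (f := fun x (j : Fin P) => x (j : ℕ)) (Set.toFinite _) ?_
  intro x hx y hy hxy
  funext i
  have hnn := Int.emod_nonneg i (by omega : (P : ℤ) ≠ 0)
  have hlt := Int.emod_lt_of_pos i (by omega : (0 : ℤ) < P)
  have := congrFun hxy ⟨(i % P).toNat, by omega⟩
  simp only [Int.toNat_of_nonneg hnn] at this
  rwa [hmod x hx, hmod y hy] at this

theorem one_le_natCard_free {A : Type*} [Finite A] {X : Set (ℤ → A)} {w u : List A}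
    (hu : inLang X u) (hf : ¬ w <:+: u) :
    1 ≤ Nat.card {v : List A // v.length = u.length ∧ inLang X v ∧ ¬ w <:+: v} := by
  have : Finite {v : List A // v.length = u.length ∧ inLang X v ∧ ¬ w <:+: v} :=
    finite_length_eq_and (fun v => inLang X v ∧ ¬ w <:+: v) u.length
  have : Nonempty {v : List A // v.length = u.length ∧ inLang X v ∧ ¬ w <:+: v} :=
    ⟨⟨u, rfl, hu, hf⟩⟩
  exact Nat.card_pos

theorem exists_occursAt_of_isInfix {A : Type*} {x : ℤ → A} {i : ℤ} {w u : List A}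
    (h : w <:+: u) (hu : occursAt x i u) : ∃ j, occursAt x j w := by
  obtain ⟨s, t, rfl⟩ := h
  exact ⟨_, (occursAt_append.mp (occursAt_append.mp hu).1).2⟩

theorem subshiftEntropy_pos {A : Type*} [Fintype A] {X : Set (ℤ → A)} (hX : IsNNSFT X)
    (hT : LangTransitive X) (hinf : X.Infinite) : 0 < subshiftEntropy X := by
  obtain ⟨z, hz, P, hP, hper⟩ := hX.exists_periodic_mem hT hinf.nonempty
  obtain ⟨x, hx, i, hi⟩ : ∃ x ∈ X, ∃ i, x (i + P) ≠ x i := by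
    by_contra! h
    exact hinf (finite_of_forall_periodic hP h)
  set w := List.ofFn fun j : Fin (P + 1) => x (i + (j : ℕ)) with hw
  have hocc : occursAt x i w := occursAt_ofFn x i (P + 1)
  have hfree : ∀ n, 1 ≤ Nat.card {u : List A // u.length = n ∧ inLang X u ∧ ¬ w <:+: u} := by
    intro n
    have hzo := occursAt_ofFn z 0 n
    have := one_le_natCard_free (w := w) (hX.inLang_of_occursAt hz hzo) fun hsub => by
      obtain ⟨j, hj⟩ := exists_occursAt_of_isInfix hsub hzo
      rw [occursAt_iff_getElem] at hj
      have h0 := hj 0 (by simp [hw])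
      have h1 := hj P (by simp [hw])
      rw [hper] at h1
      simp only [Nat.cast_zero, add_zero] at h0
      rw [h0] at h1
      simp only [hw, List.getElem_ofFn] at h1
      exact hi (by simpa using h1.symm)
    simpa using this
  have hne : w ≠ [] := by simp [hw]
  have := limsup_log_div_le_subshiftEntropy_sub hX hT (hX.inLang_of_occursAt hx hocc) hne
    (c := fun _ => 1) hfree hfree
  have hpos := log_one_add_exp_div_pos (subshiftEntropy X)
    (2 * Fintype.card A + w.length + 1) (B := Fintype.card A + w.length)
    (by have := List.length_pos_iff.mpr hne; omega)
  simp only [Nat.cast_one, Real.log_one, zero_div, limsup_const] at this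
  linarith

theorem mul_exp_lt_log_one_add_exp_div {h : ℝ} (hh : 0 ≤ h) {n k : ℕ} (hk : 0 < k) :
    h * Real.exp (-(2 * (3 * (n : ℝ) + 4 * (k : ℝ))) * h) <
      Real.log (1 + Real.exp (-h) ^ (2 * n + k + 1)) / (n + k : ℕ) := by
  have hk' : (1 : ℝ) ≤ k := by exact_mod_cast hk
  have hn : (0 : ℝ) ≤ n := n.cast_nonneg
  set x := Real.exp (-h) ^ (2 * n + k + 1) with hx
  have hx0 : 0 < x := by positivity
  have hx1 : x ≤ 1 := pow_le_one₀ (by positivity) (by simpa using hh)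
  have hlog : x / 2 ≤ Real.log (1 + x) := by
    have h1 := Real.one_sub_inv_le_log_of_pos (show 0 < 1 + x by linarith)
    refine le_trans ?_ h1
    rw [← sub_nonneg]
    have : 1 - (1 + x)⁻¹ - x / 2 = x * (1 - x) / (2 * (1 + x)) := by
      field_simp
      ring
    rw [this]
    exact div_nonneg (mul_nonneg hx0.le (by linarith)) (by linarith)
  have hexp : 2 * (n + k) * h < Real.exp ((4 * n + 7 * k - 1) * h) := by
    calc 2 * (n + k) * h ≤ (4 * n + 7 * k - 1) * h := by gcongr; linarith
      _ < _ := by linarith [Real.add_one_le_exp ((4 * n + 7 * k - 1) * h)]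
  have hxe : Real.exp ((4 * n + 7 * k - 1) * h) *
      Real.exp (-(2 * (3 * (n : ℝ) + 4 * (k : ℝ))) * h) = x := by
    rw [hx, ← Real.exp_add, ← Real.exp_nat_mul]
    congr 1
    push_cast
    ring
  rw [lt_div_iff₀ (by positivity)]
  refine lt_of_lt_of_le ?_ hlog
  have := mul_lt_mul_of_pos_right hexp
    (Real.exp_pos (-(2 * (3 * (n : ℝ) + 4 * (k : ℝ))) * h))
  rw [hxe] at this
  push_cast
  linarith

theorem natCard_inLang_avoiding_le {A : Type*} [Finite A] (X : Set (ℤ → A)) (w : List A) (n : ℕ) :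
    Nat.card {u : List A // u.length = n ∧
      inLang {x ∈ X | ∀ i : ℤ, ¬ occursAt x i w} u} ≤
    Nat.card {u : List A // u.length = n ∧ inLang X u ∧ ¬ w <:+: u} := by
  refine Set.ncard_le_ncard (s := {u : List A | u.length = n ∧
    inLang {x ∈ X | ∀ i : ℤ, ¬ occursAt x i w} u}) ?_ (finite_length_eq_and _ n)
  rintro u ⟨hu, x, ⟨hx, hfree⟩, hocc⟩
  refine ⟨hu, ⟨x, hx, hocc⟩, fun hsub => ?_⟩
  obtain ⟨j, hj⟩ := exists_occursAt_of_isInfix hsub hocc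
  exact hfree j hj

theorem IsNNSFT.subshiftEntropy_avoiding_eq_zero {A : Type*} [Finite A] {X : Set (ℤ → A)}
    (hX : IsNNSFT X) {w : List A} {N : ℕ}
    (hN : Nat.card {u : List A // u.length = N ∧ inLang X u ∧ ¬ w <:+: u} = 0) :
    subshiftEntropy {x ∈ X | ∀ i : ℤ, ¬ occursAt x i w} = 0 := by
  have hempty : {x ∈ X | ∀ i : ℤ, ¬ occursAt x i w} = ∅ := by
    rw [Set.eq_empty_iff_forall_notMem]
    rintro x ⟨hx, hfree⟩
    have hocc := occursAt_ofFn x 0 N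
    have := one_le_natCard_free (w := w) (hX.inLang_of_occursAt hx hocc) fun hsub => by
      obtain ⟨j, hj⟩ := exists_occursAt_of_isInfix hsub hocc
      exact hfree j hj
    simp only [List.length_ofFn] at this
    omega
  simp [subshiftEntropy, hempty, inLang]

theorem entropy_drop_single_word {A : Type*} [Fintype A]
    (X : Set (ℤ → A)) (hsft : IsNNSFT X) (htrans : LangTransitive X)
    (hinf : X.Infinite) (w : List A) (hw : inLang X w) (hk : 1 < w.length) :
    subshiftEntropy X - subshiftEntropy { x ∈ X | ∀ i : ℤ, ¬ occursAt x i w } >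
      subshiftEntropy X *
        Real.exp (-(2 * (3 * (Fintype.card A : ℝ) + 4 * (w.length : ℝ))) *
          subshiftEntropy X) := by
  set h := subshiftEntropy X with hh
  have hpos : 0 < h := subshiftEntropy_pos hsft htrans hinf
  by_cases hfree : ∀ n, 1 ≤ Nat.card {u : List A // u.length = n ∧ inLang X u ∧ ¬ w <:+: u}
  · have h1 := limsup_log_div_le_subshiftEntropy_sub hsft htrans hw
      (List.length_pos_iff.mp (by omega)) (natCard_inLang_avoiding_le X w) hfree
    have h2 := mul_exp_lt_log_one_add_exp_div hpos.le (n := Fintype.card A)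
      (show 0 < w.length by omega)
    rw [← hh] at h1
    unfold subshiftEntropy
    change _ < h - _
    linarith
  · push Not at hfree
    obtain ⟨N, hN⟩ := hfree
    rw [hsft.subshiftEntropy_avoiding_eq_zero (Nat.lt_one_iff.mp hN), sub_zero]
    refine mul_lt_of_lt_one_right hpos (Real.exp_lt_one_iff.mpr ?_)
    rw [neg_mul, neg_lt_zero]
    have : (0 : ℝ) < w.length := by exact_mod_cast (show 0 < w.length by omega)
    positivity
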